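/- (Additive variational principle) Let (X,T) be a TDS, φ : X → ℝ continuous, Φ the additive sequence φ_n = Σ_{j<n} φ∘T^j, and Z ⊆ X nonempty compact. Then P^B̃_Z(T,Φ) = lim_{ε→0} sup{P̲^B̃K_μ(T,Φ,ε) : μ ∈ M(X), μ(Z)=1} = lim_{ε→0} sup{P^K̃_μ(T,Φ,ε) : μ ∈ M(X), μ(Z)=1}. -/

import Mathlib

open Filter Set MeasureTheory Metric Topology ENNReal

variable {X : Type*} [MetricSpace X]

/-- The Bowen ball of order `n` and radius `r` around `x`. -/
def bowenBall (T : X → X) (n : ℕ) (x : X) (r : ℝ) : Set X :=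
  {y | ∀ j < n, dist (T^[j] x) (T^[j] y) < r}

/-- The neutralized Bowen ball `B_n(x, e^{-nε})`. -/
noncomputable def nBall (T : X → X) (n : ℕ) (ε : ℝ) (x : X) : Set X :=
  bowenBall T n x (Real.exp (-(n * ε)))

/-- The weight `exp[-n s + sup_{B_n(x,e^{-nε})} φ_n]` of a neutralized Bowen ball. -/
noncomputable def wSup (T : X → X) (φ : ℕ → X → ℝ) (s ε : ℝ) (n : ℕ) (x : X) : ℝ≥0∞ :=
  ENNReal.ofReal (Real.exp (-(n : ℝ) * s + sSup ((φ n) '' nBall T n ε x)))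

/-- `M^s_{N,ε}(Z,Φ)`: infimum over countable covers of `Z` by neutralized Bowen balls
of orders `≥ N`. -/
noncomputable def MN (T : X → X) (φ : ℕ → X → ℝ) (Z : Set X) (s ε : ℝ) (N : ℕ) : ℝ≥0∞ :=
  ⨅ (D : Set (X × ℕ)) (_ : D.Countable) (_ : ∀ p ∈ D, N ≤ p.2)
    (_ : Z ⊆ ⋃ p ∈ D, nBall T p.2 ε p.1),
    ∑' p : D, wSup T φ s ε p.1.2 p.1.1

/-- `M^s_ε(Z,Φ) = lim_{N→∞} M^s_{N,ε}(Z,Φ)` (the limit of a nondecreasing sequence). -/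
noncomputable def Mlim (T : X → X) (φ : ℕ → X → ℝ) (Z : Set X) (s ε : ℝ) : ℝ≥0∞ :=
  ⨆ N, MN T φ Z s ε N

/-- The critical value `M_ε(Z,Φ)`. -/
noncomputable def Mcrit (T : X → X) (φ : ℕ → X → ℝ) (Z : Set X) (ε : ℝ) : ℝ :=
  sInf {s | Mlim T φ Z s ε = 0}

/-- The non-additive neutralized Bowen topological pressure
`P^B̃_Z(T,Φ) = lim_{ε→0} M_ε(Z,Φ) = inf_{ε>0} M_ε(Z,Φ)`. -/
noncomputable def PB (T : X → X) (φ : ℕ → X → ℝ) (Z : Set X) : ℝ :=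
  sInf (Mcrit T φ Z '' Ioi 0)

/-- `M̃^s_{N,ε}(Z,Φ)`: as `M^s_{N,ε}` but with the potential evaluated at an arbitrary
chosen point `z_i` of each covering ball. -/
noncomputable def MtN (T : X → X) (φ : ℕ → X → ℝ) (Z : Set X) (s ε : ℝ) (N : ℕ) : ℝ≥0∞ :=
  ⨅ (D : Set ((X × ℕ) × X)) (_ : D.Countable)
    (_ : ∀ p ∈ D, N ≤ p.1.2 ∧ p.2 ∈ nBall T p.1.2 ε p.1.1)
    (_ : Z ⊆ ⋃ p ∈ D, nBall T p.1.2 ε p.1.1),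
    ∑' p : D, ENNReal.ofReal (Real.exp (-(p.1.1.2 : ℝ) * s + φ p.1.1.2 p.1.2))

noncomputable def Mtlim (T : X → X) (φ : ℕ → X → ℝ) (Z : Set X) (s ε : ℝ) : ℝ≥0∞ :=
  ⨆ N, MtN T φ Z s ε N

noncomputable def MtCrit (T : X → X) (φ : ℕ → X → ℝ) (Z : Set X) (ε : ℝ) : ℝ :=
  sInf {s | Mtlim T φ Z s ε = 0}

/-- `𝓜^s_{N,ε}(Z,Φ)`: as `M^s_{N,ε}` but with the potential evaluated at the centers. -/
noncomputable def McN (T : X → X) (φ : ℕ → X → ℝ) (Z : Set X) (s ε : ℝ) (N : ℕ) : ℝ≥0∞ :=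
  ⨅ (D : Set (X × ℕ)) (_ : D.Countable) (_ : ∀ p ∈ D, N ≤ p.2)
    (_ : Z ⊆ ⋃ p ∈ D, nBall T p.2 ε p.1),
    ∑' p : D, ENNReal.ofReal (Real.exp (-(p.1.2 : ℝ) * s + φ p.1.2 p.1.1))

/-- `W^s_{N,ε}(Z,Φ)`: the weighted version, over countable families of neutralized Bowen
balls with positive coefficients `c_i` such that `Σ c_i χ_{B_i} ≥ χ_Z`. -/
noncomputable def WN (T : X → X) (φ : ℕ → X → ℝ) (Z : Set X) (s ε : ℝ) (N : ℕ) : ℝ≥0∞ :=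
  ⨅ (D : Set ((X × ℕ) × ℝ)) (_ : D.Countable)
    (_ : ∀ p ∈ D, N ≤ p.1.2 ∧ 0 < p.2)
    (_ : ∀ x ∈ Z, (1 : ℝ≥0∞) ≤ ∑' p : D,
        (nBall T p.1.1.2 ε p.1.1.1).indicator (fun _ => ENNReal.ofReal p.1.2) x),
    ∑' p : D, ENNReal.ofReal p.1.2 * wSup T φ s ε p.1.1.2 p.1.1.1

noncomputable def Wlim (T : X → X) (φ : ℕ → X → ℝ) (Z : Set X) (s ε : ℝ) : ℝ≥0∞ :=
  ⨆ N, WN T φ Z s ε N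

noncomputable def Wcrit (T : X → X) (φ : ℕ → X → ℝ) (Z : Set X) (ε : ℝ) : ℝ :=
  sInf {s | Wlim T φ Z s ε = 0}

/-- The non-additive neutralized weighted Bowen topological pressure `P^W̃B_Z(T,Φ)`. -/
noncomputable def PWB (T : X → X) (φ : ℕ → X → ℝ) (Z : Set X) : ℝ :=
  sInf (Wcrit T φ Z '' Ioi 0)

/-- The distortion `φ_n(ε) = sup{|φ_n(x) - φ_n(y)| : x ∈ X, y ∈ B_n(x, e^{-nε})}`. -/
noncomputable def distortion (T : X → X) (φ : ℕ → X → ℝ) (n : ℕ) (ε : ℝ) : ℝ :=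
  sSup {r | ∃ x y, y ∈ nBall T n ε x ∧ r = |φ n x - φ n y|}

/-- The tempered distortion condition `lim_{ε→0} limsup_{n→∞} φ_n(ε)/n = 0`. -/
def Tempered (T : X → X) (φ : ℕ → X → ℝ) : Prop :=
  Tendsto (fun ε => limsup (fun n : ℕ => distortion T φ n ε / n) atTop)
    (𝓝[>] (0 : ℝ)) (𝓝 0)

section Measures

variable [MeasurableSpace X]

/-- `Λ^s_{N,ε}(μ,Φ,δ)`: infimum over countable families of neutralized Bowen balls of
orders `≥ N` whose union has `μ`-measure `> 1 - δ`. -/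
noncomputable def ΛN (T : X → X) (φ : ℕ → X → ℝ) (μ : Measure X) (s ε δ : ℝ) (N : ℕ) :
    ℝ≥0∞ :=
  ⨅ (D : Set (X × ℕ)) (_ : D.Countable) (_ : ∀ p ∈ D, N ≤ p.2)
    (_ : ENNReal.ofReal (1 - δ) < μ (⋃ p ∈ D, nBall T p.2 ε p.1)),
    ∑' p : D, wSup T φ s ε p.1.2 p.1.1

noncomputable def Λlim (T : X → X) (φ : ℕ → X → ℝ) (μ : Measure X) (s ε δ : ℝ) : ℝ≥0∞ :=
  ⨆ N, ΛN T φ μ s ε δ N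

/-- The critical value `Λ_ε(μ,Φ,δ)`. -/
noncomputable def Λcrit (T : X → X) (φ : ℕ → X → ℝ) (μ : Measure X) (ε δ : ℝ) : ℝ :=
  sInf {s | Λlim T φ μ s ε δ = 0}

/-- The neutralized Katok pressure `P^K̃_μ(T,Φ,ε) = lim_{δ→0} Λ_ε(μ,Φ,δ)`. -/
noncomputable def PK (T : X → X) (φ : ℕ → X → ℝ) (μ : Measure X) (ε : ℝ) : ℝ :=
  sSup ((fun δ => Λcrit T φ μ ε δ) '' Ioo (0 : ℝ) 1)

/-- The lower neutralized Brin–Katok local pressure at `x`. -/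
noncomputable def PBKx (T : X → X) (φ : ℕ → X → ℝ) (μ : Measure X) (ε : ℝ) (x : X) : ℝ :=
  liminf (fun n : ℕ => (-Real.log ((μ (nBall T n ε x)).toReal) + φ n x) / n) atTop

/-- The lower neutralized Brin–Katok local pressure `P̲^B̃K_μ(T,Φ,ε)`. -/
noncomputable def PBK (T : X → X) (φ : ℕ → X → ℝ) (μ : Measure X) (ε : ℝ) : ℝ :=
  ∫ x, PBKx T φ μ ε x ∂μ

/-- `sup{P̲^B̃K_μ(T,Φ,ε) : μ ∈ M(X), μ(Z) = 1}`. -/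
noncomputable def supBK (T : X → X) (φ : ℕ → X → ℝ) (Z : Set X) (ε : ℝ) : ℝ :=
  sSup {p | ∃ μ : Measure X, IsProbabilityMeasure μ ∧ μ Z = 1 ∧ p = PBK T φ μ ε}

/-- `lim_{ε→0} sup{P̲^B̃K_μ(T,Φ,ε) : μ(Z)=1}`, realized as the infimum over `ε > 0`. -/
noncomputable def limSupBK (T : X → X) (φ : ℕ → X → ℝ) (Z : Set X) : ℝ :=
  sInf (supBK T φ Z '' Ioi 0)

/-- `sup{P^K̃_μ(T,Φ,ε) : μ ∈ M(X), μ(Z) = 1}`. -/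
noncomputable def supK (T : X → X) (φ : ℕ → X → ℝ) (Z : Set X) (ε : ℝ) : ℝ :=
  sSup {p | ∃ μ : Measure X, IsProbabilityMeasure μ ∧ μ Z = 1 ∧ p = PK T φ μ ε}

/-- `lim_{ε→0} sup{P^K̃_μ(T,Φ,ε) : μ(Z)=1}`, realized as the infimum over `ε > 0`. -/
noncomputable def limSupK (T : X → X) (φ : ℕ → X → ℝ) (Z : Set X) : ℝ :=
  sInf (supK T φ Z '' Ioi 0)

end Measures

section NeutralizedBalls

variable {T : X → X} {ε : ℝ} {m n κ : ℕ} {a b c d e x y : X}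

lemma nBall_zero (T : X → X) (ε : ℝ) (x : X) : nBall T 0 ε x = univ := by
  simp [nBall, bowenBall]

lemma mem_nBall_self (T : X → X) (n : ℕ) (ε : ℝ) (x : X) : x ∈ nBall T n ε x := by
  intro j _
  simpa using Real.exp_pos _

lemma mem_nBall_comm : y ∈ nBall T n ε x ↔ x ∈ nBall T n ε y := by
  simp only [nBall, bowenBall, mem_ofPred_eq, dist_comm]

lemma nBall_anti (hε : 0 < ε) (h : m ≤ n) (x : X) : nBall T n ε x ⊆ nBall T m ε x := by
  intro y hy j hj
  refine (hy j (hj.trans_le h)).trans_le (Real.exp_le_exp.2 ?_)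
  have : (m : ℝ) ≤ n := by exact_mod_cast h
  nlinarith

lemma isOpen_setOf_mem_nBall (hT : Continuous T) (n : ℕ) (ε : ℝ) :
    IsOpen {p : X × X | p.2 ∈ nBall T n ε p.1} := by
  have : {p : X × X | p.2 ∈ nBall T n ε p.1} =
      ⋂ j ∈ Finset.range n, {p : X × X | dist (T^[j] p.1) (T^[j] p.2) < Real.exp (-(n * ε))} := by
    ext p
    simp [nBall, bowenBall]
  rw [this]
  refine isOpen_biInter_finset fun j _ => isOpen_lt ?_ continuous_const
  exact ((hT.iterate j).comp continuous_fst).dist ((hT.iterate j).comp continuous_snd)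

lemma isOpen_nBall (hT : Continuous T) (n : ℕ) (ε : ℝ) (x : X) : IsOpen (nBall T n ε x) :=
  (isOpen_setOf_mem_nBall hT n ε).preimage (Continuous.prodMk_right x)

lemma exists_four_le_exp (hε : 0 < ε) : ∃ κ : ℕ, 4 ≤ Real.exp (κ * ε) := by
  obtain ⟨κ, hκ⟩ := exists_nat_gt (4 / ε)
  refine ⟨κ, ?_⟩
  have := (div_lt_iff₀ hε).1 hκ
  linarith [Real.add_one_le_exp (κ * ε)]

/-- Four steps at order `n` stay in a ball of order `n - κ`. -/
lemma mem_nBall_sub (hκ : 4 ≤ Real.exp (κ * ε))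
    (hb : b ∈ nBall T n ε a) (hc : c ∈ nBall T n ε b)
    (hd : d ∈ nBall T n ε c) (he : e ∈ nBall T n ε d) : e ∈ nBall T (n - κ) ε a := by
  rcases le_total n κ with h | h
  · rw [Nat.sub_eq_zero_of_le h, nBall_zero]
    trivial
  intro j hj
  have hj' : j < n := hj.trans_le (Nat.sub_le _ _)
  have h1 := hb j hj'
  have h2 := hc j hj'
  have h3 := hd j hj'
  have h4 := he j hj'
  have key : 4 * Real.exp (-(n * ε)) ≤ Real.exp (-((n - κ : ℕ) * ε)) := by
    have : Real.exp (-((n - κ : ℕ) * ε)) = Real.exp (κ * ε) * Real.exp (-(n * ε)) := by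
      rw [← Real.exp_add, Nat.cast_sub h]
      ring_nf
    rw [this]
    gcongr
  have t1 := dist_triangle (T^[j] a) (T^[j] b) (T^[j] c)
  have t2 := dist_triangle (T^[j] a) (T^[j] c) (T^[j] d)
  have t3 := dist_triangle (T^[j] a) (T^[j] d) (T^[j] e)
  linarith

lemma nBall_subset_sub (hκ : 4 ≤ Real.exp (κ * ε)) (hy : y ∈ nBall T n ε x) :
    nBall T n ε x ⊆ nBall T (n - κ) ε y := fun _ hz =>
  mem_nBall_sub hκ (mem_nBall_comm.1 hy) (mem_nBall_self T n ε x) (mem_nBall_self T n ε x) hz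

end NeutralizedBalls

/-- The properties of the Birkhoff sums of a bounded uniformly continuous potential which the
variational principle uses: linear growth, bounded change under a bounded change of order, and
subexponential distortion on neutralized Bowen balls. -/
structure IsTame (T : X → X) (φ : ℕ → X → ℝ) (ε M : ℝ) : Prop where
  nonneg : 0 ≤ M
  abs_le : ∀ n x, |φ n x| ≤ n * M
  abs_sub_le : ∀ n k x, |φ (n - k) x - φ n x| ≤ k * M
  distortion : ∀ η > 0, ∃ C ≥ 0, ∀ n x y, y ∈ nBall T n ε x → |φ n x - φ n y| ≤ C + η * n

lemma isTame_birkhoffSum [CompactSpace X] {T : X → X} {φ₀ : X → ℝ}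
    (hφ₀ : Continuous φ₀) {ε : ℝ} (hε : 0 < ε) :
    ∃ M, IsTame T (fun n x => ∑ j ∈ Finset.range n, φ₀ (T^[j] x)) ε M := by
  obtain ⟨M, hM⟩ : ∃ M, 0 ≤ M ∧ ∀ x, |φ₀ x| ≤ M := by
    obtain ⟨M, hM⟩ := (isCompact_range hφ₀).isBounded.exists_norm_le
    exact ⟨max M 0, le_max_right _ _, fun x => (hM _ ⟨x, rfl⟩).trans (le_max_left _ _)⟩
  obtain ⟨hM0, hM⟩ := hM
  refine ⟨M, hM0, fun n x => ?_, fun n k x => ?_, fun η hη => ?_⟩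
  · refine (Finset.abs_sum_le_sum_abs _ _).trans ?_
    simpa using Finset.sum_le_card_nsmul (Finset.range n) _ M fun j _ => hM (T^[j] x)
  · rw [abs_sub_comm, ← Finset.sum_sdiff_eq_sub (Finset.range_mono (Nat.sub_le n k))]
    refine (Finset.abs_sum_le_sum_abs _ _).trans ?_
    refine (Finset.sum_le_card_nsmul _ _ M fun j _ => hM (T^[j] x)).trans ?_
    rw [nsmul_eq_mul, Finset.card_sdiff_of_subset (Finset.range_mono (Nat.sub_le n k))]
    gcongr
    simp
    omega
  · obtain ⟨δ, hδ, hu⟩ :=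
      Metric.uniformContinuous_iff.1 (CompactSpace.uniformContinuous_of_continuous hφ₀) η hη
    have hlim : Tendsto (fun n : ℕ => Real.exp (-(n * ε))) atTop (𝓝 0) :=
      Real.tendsto_exp_neg_atTop_nhds_zero.comp
        (tendsto_natCast_atTop_atTop.atTop_mul_const hε)
    obtain ⟨n₁, hn₁⟩ := eventually_atTop.1 (hlim.eventually (gt_mem_nhds hδ))
    refine ⟨n₁ * (2 * M), by positivity, fun n x y hy => ?_⟩
    rw [← Finset.sum_sub_distrib]
    refine (Finset.abs_sum_le_sum_abs _ _).trans ?_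
    rcases le_total n₁ n with h | h
    · have : ∀ j ∈ Finset.range n, |φ₀ (T^[j] x) - φ₀ (T^[j] y)| ≤ η := fun j hj =>
        (hu ((hy j (Finset.mem_range.1 hj)).trans (hn₁ n h))).le
      have := Finset.sum_le_card_nsmul _ _ _ this
      simp only [Finset.card_range, nsmul_eq_mul] at this
      have h0 : 0 ≤ n₁ * (2 * M) := by positivity
      linarith
    · have : ∀ j ∈ Finset.range n, |φ₀ (T^[j] x) - φ₀ (T^[j] y)| ≤ 2 * M := fun j _ => by
        have h1 := abs_sub (φ₀ (T^[j] x)) (φ₀ (T^[j] y))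
        linarith [hM (T^[j] x), hM (T^[j] y)]
      have := Finset.sum_le_card_nsmul _ _ _ this
      simp only [Finset.card_range, nsmul_eq_mul] at this
      have h0 : (n : ℝ) * (2 * M) ≤ n₁ * (2 * M) := by gcongr
      have h1 : 0 ≤ η * n := by positivity
      linarith

section Weights

variable {T : X → X} {φ : ℕ → X → ℝ} {ε M : ℝ}

lemma IsTame.bddAbove (h : IsTame T φ ε M) (n : ℕ) (x : X) :
    BddAbove (φ n '' nBall T n ε x) := by
  refine ⟨n * M, ?_⟩
  rintro _ ⟨y, -, rfl⟩
  exact (le_abs_self _).trans (h.abs_le n y)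

lemma IsTame.le_wSup (h : IsTame T φ ε M) (s : ℝ) (n : ℕ) (x : X) :
    ENNReal.ofReal (Real.exp (-n * s + φ n x)) ≤ wSup T φ s ε n x := by
  refine ENNReal.ofReal_le_ofReal (Real.exp_le_exp.2 ?_)
  gcongr
  exact le_csSup (h.bddAbove n x) ⟨x, mem_nBall_self T n ε x, rfl⟩

lemma wSup_le {C : ℝ} {n : ℕ} {x : X} (h : ∀ y ∈ nBall T n ε x, |φ n x - φ n y| ≤ C) (s : ℝ) :
    wSup T φ s ε n x ≤ ENNReal.ofReal (Real.exp (-n * s + φ n x + C)) := by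
  refine ENNReal.ofReal_le_ofReal (Real.exp_le_exp.2 ?_)
  rw [add_assoc]
  gcongr
  refine csSup_le ⟨_, x, mem_nBall_self T n ε x, rfl⟩ ?_
  rintro _ ⟨y, hy, rfl⟩
  linarith [neg_abs_le (φ n x - φ n y), h y hy]

lemma IsTame.wSup_le (h : IsTame T φ ε M) (s : ℝ) (n : ℕ) (x : X) :
    wSup T φ s ε n x ≤ ENNReal.ofReal (Real.exp (-n * (s - M))) := by
  refine ENNReal.ofReal_le_ofReal (Real.exp_le_exp.2 ?_)
  have : sSup (φ n '' nBall T n ε x) ≤ n * M := by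
    refine csSup_le ⟨_, x, mem_nBall_self T n ε x, rfl⟩ ?_
    rintro _ ⟨y, hy, rfl⟩
    exact (le_abs_self _).trans (h.abs_le n y)
  linarith

lemma IsTame.one_le_wSup (h : IsTame T φ ε M) {s : ℝ} (hs : s ≤ -M) (n : ℕ) (x : X) :
    1 ≤ wSup T φ s ε n x := by
  refine le_trans ?_ (h.le_wSup s n x)
  rw [ENNReal.one_le_ofReal, Real.one_le_exp_iff]
  have h1 := neg_abs_le (φ n x)
  have h2 := h.abs_le n x
  have h3 : (n : ℝ) * s ≤ n * (-M) := by gcongr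
  linarith

lemma wSup_anti {s s' : ℝ} (h : s ≤ s') (n : ℕ) (x : X) :
    wSup T φ s' ε n x ≤ wSup T φ s ε n x := by
  refine ENNReal.ofReal_le_ofReal (Real.exp_le_exp.2 ?_)
  have : (n : ℝ) * s ≤ n * s' := by gcongr
  linarith

end Weights

section LocalPressure

variable [MeasurableSpace X] {T : X → X} {φ : ℕ → X → ℝ} {ε M : ℝ} {μ : Measure X}

lemma neg_le_localRate (h : IsTame T φ ε M) [IsProbabilityMeasure μ] (n : ℕ) (x : X) :
    -M ≤ (-Real.log (μ (nBall T n ε x)).toReal + φ n x) / n := by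
  rcases n.eq_zero_or_pos with rfl | hn
  · simpa using h.nonneg
  have hn' : (0 : ℝ) < n := by exact_mod_cast hn
  rw [le_div_iff₀ hn']
  have h1 := neg_abs_le (φ n x)
  have h2 := h.abs_le n x
  have h3 : Real.log (μ (nBall T n ε x)).toReal ≤ 0 :=
    Real.log_nonpos ENNReal.toReal_nonneg (by simpa [Measure.real] using measureReal_le_one)
  linarith

lemma frequently_localRate_le [IsProbabilityMeasure μ] {c : ℝ} {x : X}
    (hx : ∃ᶠ n in atTop, ENNReal.ofReal (Real.exp (-n * c + φ n x)) ≤ μ (nBall T n ε x)) :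
    ∃ᶠ n : ℕ in atTop, (-Real.log (μ (nBall T n ε x)).toReal + φ n x) / n ≤ c := by
  refine (hx.and_eventually (eventually_gt_atTop 0)).mono fun n ⟨h1, hn⟩ => ?_
  have hn' : (0 : ℝ) < n := by exact_mod_cast hn
  rw [div_le_iff₀ hn']
  rw [ENNReal.ofReal_le_iff_le_toReal (measure_ne_top _ _)] at h1
  have := Real.log_le_log (Real.exp_pos _) h1
  rw [Real.log_exp] at this
  linarith

lemma measure_nBall_pos (hε : 0 < ε) {c : ℝ} {x : X}
    (hx : ∃ᶠ n in atTop, ENNReal.ofReal (Real.exp (-n * c + φ n x)) ≤ μ (nBall T n ε x))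
    (n : ℕ) : 0 < μ (nBall T n ε x) := by
  obtain ⟨m, hm, h⟩ := frequently_atTop.1 hx n
  exact ((ENNReal.ofReal_pos.2 (Real.exp_pos _)).trans_le h).trans_le
    (measure_mono (nBall_anti hε hm x))

lemma PBKx_le (h : IsTame T φ ε M) [IsProbabilityMeasure μ] {c : ℝ} {x : X}
    (hx : ∃ᶠ n in atTop, ENNReal.ofReal (Real.exp (-n * c + φ n x)) ≤ μ (nBall T n ε x)) :
    PBKx T φ μ ε x ≤ c :=
  liminf_le_of_frequently_le (frequently_localRate_le hx)
    (isBoundedUnder_of ⟨-M, fun n => neg_le_localRate h n x⟩)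

lemma le_PBKx_of_eventually [IsProbabilityMeasure μ] {c s : ℝ} {x : X}
    (hx : ∃ᶠ n in atTop, ENNReal.ofReal (Real.exp (-n * c + φ n x)) ≤ μ (nBall T n ε x))
    (hs : ∀ᶠ n : ℕ in atTop, s ≤ (-Real.log (μ (nBall T n ε x)).toReal + φ n x) / n) :
    s ≤ PBKx T φ μ ε x :=
  le_liminf_of_le (IsCoboundedUnder.of_frequently_le (frequently_localRate_le hx)) hs

lemma neg_le_PBKx (h : IsTame T φ ε M) [IsProbabilityMeasure μ] {c : ℝ} {x : X}
    (hx : ∃ᶠ n in atTop, ENNReal.ofReal (Real.exp (-n * c + φ n x)) ≤ μ (nBall T n ε x)) :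
    -M ≤ PBKx T φ μ ε x :=
  le_PBKx_of_eventually hx (Eventually.of_forall fun n => neg_le_localRate h n x)

lemma le_PBKx [IsProbabilityMeasure μ] (hε : 0 < ε) {c s C : ℝ} {N : ℕ} {x : X} (hC : 0 < C)
    (hx : ∃ᶠ n in atTop, ENNReal.ofReal (Real.exp (-n * c + φ n x)) ≤ μ (nBall T n ε x))
    (hs : ∀ n ≥ N, μ (nBall T n ε x) ≤ ENNReal.ofReal (C * Real.exp (-n * s + φ n x))) :
    s ≤ PBKx T φ μ ε x := by
  refine le_of_forall_lt fun s' hs' => (show s' < (s' + s) / 2 by linarith).trans_le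
    (le_PBKx_of_eventually hx ?_)
  have hlim : Tendsto (fun n : ℕ => (n : ℝ) * ((s - s') / 2)) atTop atTop :=
    tendsto_natCast_atTop_atTop.atTop_mul_const (by linarith)
  filter_upwards [eventually_ge_atTop N, eventually_gt_atTop 0,
    hlim.eventually_ge_atTop (Real.log C)] with n hn hn0 hnC
  have hn' : (0 : ℝ) < n := by exact_mod_cast hn0
  rw [le_div_iff₀ hn']
  have h1 := ENNReal.toReal_mono ENNReal.ofReal_ne_top (hs n hn)
  rw [ENNReal.toReal_ofReal (by positivity)] at h1
  have h2 := Real.log_le_log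
    (ENNReal.toReal_pos (measure_nBall_pos hε hx n).ne' (measure_ne_top _ _)) h1
  rw [Real.log_mul hC.ne' (Real.exp_pos _).ne', Real.log_exp] at h2
  linarith

lemma measurable_PBKx [BorelSpace X] [CompactSpace X] [SFinite μ] (hT : Continuous T)
    (hφ : ∀ n, Continuous (φ n)) : Measurable (PBKx T φ μ ε) := by
  refine Measurable.liminf fun n => ?_
  have : Measurable fun x => μ (nBall T n ε x) :=
    measurable_measure_prodMk_left (isOpen_setOf_mem_nBall hT n ε).measurableSet
  exact ((Real.measurable_log.comp this.ennreal_toReal).neg.add (hφ n).measurable).div_const _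

lemma integrable_PBKx [BorelSpace X] [CompactSpace X] [IsProbabilityMeasure μ]
    (hT : Continuous T) (hφ : ∀ n, Continuous (φ n)) (h : IsTame T φ ε M) {c : ℝ}
    (hμ : ∀ᵐ x ∂μ, ∃ᶠ n in atTop,
      ENNReal.ofReal (Real.exp (-n * c + φ n x)) ≤ μ (nBall T n ε x)) :
    Integrable (PBKx T φ μ ε) μ :=
  Integrable.of_mem_Icc (-M) c (measurable_PBKx hT hφ).aemeasurable
    (hμ.mono fun _ hx => ⟨neg_le_PBKx h hx, PBKx_le h hx⟩)

lemma PBK_le [BorelSpace X] [CompactSpace X] [IsProbabilityMeasure μ]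
    (hT : Continuous T) (hφ : ∀ n, Continuous (φ n)) (h : IsTame T φ ε M) {c : ℝ}
    (hμ : ∀ᵐ x ∂μ, ∃ᶠ n in atTop,
      ENNReal.ofReal (Real.exp (-n * c + φ n x)) ≤ μ (nBall T n ε x)) :
    PBK T φ μ ε ≤ c := by
  have := integral_mono_ae (integrable_PBKx hT hφ h hμ) (integrable_const c)
    (hμ.mono fun _ hx => PBKx_le h hx)
  simpa [PBK] using this

lemma le_PBK [BorelSpace X] [CompactSpace X] [IsProbabilityMeasure μ] (hε : 0 < ε)
    (hT : Continuous T) (hφ : ∀ n, Continuous (φ n)) (h : IsTame T φ ε M) {c s C : ℝ} {N : ℕ}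
    (hC : 0 < C)
    (hμ : ∀ᵐ x ∂μ, ∃ᶠ n in atTop,
      ENNReal.ofReal (Real.exp (-n * c + φ n x)) ≤ μ (nBall T n ε x))
    (hs : ∀ n ≥ N, ∀ x, μ (nBall T n ε x) ≤ ENNReal.ofReal (C * Real.exp (-n * s + φ n x))) :
    s ≤ PBK T φ μ ε := by
  have := integral_mono_ae (integrable_const s) (integrable_PBKx hT hφ h hμ)
    (hμ.mono fun x hx => le_PBKx hε hC hx fun n hn => hs n hn x)
  simpa [PBK] using this

end LocalPressure

section KatokPressure

variable [MeasurableSpace X] {T : X → X} {φ : ℕ → X → ℝ} {ε M : ℝ} {μ : Measure X}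

lemma ΛN_mono (s δ : ℝ) : Monotone (ΛN T φ μ s ε δ) := fun _ _ h =>
  le_iInf₂ fun D hD => le_iInf₂ fun hN hc =>
    iInf₂_le_of_le D hD (iInf₂_le_of_le (fun p hp => h.trans (hN p hp)) hc le_rfl)

/-- If `μ(B) ≤ C e^{-ns + φ_n}` for all neutralized balls of large order, then the Katok sums
with exponent `s` do not vanish. -/
lemma Λlim_ne_zero (h : IsTame T φ ε M) {s C δ : ℝ} {N : ℕ} (hC : 0 < C) (hδ : δ < 1)
    (hs : ∀ n ≥ N, ∀ x, μ (nBall T n ε x) ≤ ENNReal.ofReal (C * Real.exp (-n * s + φ n x))) :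
    Λlim T φ μ s ε δ ≠ 0 := by
  intro h0
  have hN : ΛN T φ μ s ε δ N = 0 := le_antisymm ((le_iSup _ N).trans h0.le) bot_le
  have hC' : ENNReal.ofReal C ≠ 0 := (ENNReal.ofReal_pos.2 hC).ne'
  have key : ENNReal.ofReal (1 - δ) / ENNReal.ofReal C ≤ ΛN T φ μ s ε δ N := by
    refine le_iInf₂ fun D hD => le_iInf₂ fun hN hc => ?_
    refine ENNReal.div_le_of_le_mul' ?_
    have := hD.to_subtype
    rw [biUnion_eq_iUnion] at hc
    refine hc.le.trans ((measure_iUnion_le _).trans ?_)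
    rw [← ENNReal.tsum_mul_left]
    refine ENNReal.tsum_le_tsum fun p => (hs _ (hN _ p.2) _).trans ?_
    rw [ENNReal.ofReal_mul hC.le]
    gcongr
    exact h.le_wSup _ _ _
  rw [hN, nonpos_iff_eq_zero, ENNReal.div_eq_zero_iff] at key
  rcases key with h1 | h1
  · exact (ENNReal.ofReal_pos.2 (sub_pos.2 hδ)).ne' h1
  · exact ENNReal.ofReal_ne_top h1

lemma Λlim_ne_zero_of_le_neg (h : IsTame T φ ε M) {s δ : ℝ} (hs : s ≤ -M) :
    Λlim T φ μ s ε δ ≠ 0 := by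
  have key : 1 ≤ ΛN T φ μ s ε δ 0 := by
    refine le_iInf₂ fun D hD => le_iInf₂ fun hN hc => ?_
    obtain ⟨p, hp⟩ : D.Nonempty := by
      by_contra hne
      rw [not_nonempty_iff_eq_empty] at hne
      simp [hne] at hc
    exact (h.one_le_wSup hs _ _).trans (ENNReal.le_tsum (⟨p, hp⟩ : D))
  intro h0
  have := key.trans ((le_iSup _ 0).trans h0.le)
  simp at this

lemma Λcrit_le (h : IsTame T φ ε M) {δ s : ℝ} (hs : Λlim T φ μ s ε δ = 0) :
    Λcrit T φ μ ε δ ≤ s :=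
  csInf_le ⟨-M, fun _ hs' => le_of_lt (not_le.1 fun hle => Λlim_ne_zero_of_le_neg h hle hs')⟩ hs

lemma Λlim_anti {s s' δ : ℝ} (hs : s ≤ s') : Λlim T φ μ s' ε δ ≤ Λlim T φ μ s ε δ := by
  refine iSup_mono fun N => le_iInf₂ fun D hD => le_iInf₂ fun hN hc => ?_
  exact iInf₂_le_of_le D hD (iInf₂_le_of_le hN hc
    (ENNReal.tsum_le_tsum fun p => wSup_anti hs _ _))

lemma PK_le (h : IsTame T φ ε M) {s : ℝ} (hs : ∀ δ ∈ Ioo (0 : ℝ) 1, Λlim T φ μ s ε δ = 0) :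
    PK T φ μ ε ≤ s := by
  refine csSup_le ((nonempty_Ioo.2 one_pos).image _) ?_
  rintro _ ⟨δ, hδ, rfl⟩
  exact Λcrit_le h (hs δ hδ)

lemma le_PK (h : IsTame T φ ε M) {s t C : ℝ} {N : ℕ} (hC : 0 < C)
    (hs : ∀ n ≥ N, ∀ x, μ (nBall T n ε x) ≤ ENNReal.ofReal (C * Real.exp (-n * s + φ n x)))
    (ht : ∀ δ ∈ Ioo (0 : ℝ) 1, Λlim T φ μ t ε δ = 0) :
    s ≤ PK T φ μ ε := by
  have hhalf : (1 / 2 : ℝ) ∈ Ioo (0 : ℝ) 1 := by norm_num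
  refine le_csSup_of_le ⟨t, ?_⟩ ⟨1 / 2, hhalf, rfl⟩ ?_
  · rintro _ ⟨δ, hδ, rfl⟩
    exact Λcrit_le h (ht δ hδ)
  · refine le_csInf ⟨t, ht _ hhalf⟩ fun s' hs' => le_of_not_gt fun hlt => ?_
    refine Λlim_ne_zero h hC hhalf.2 hs (le_antisymm ?_ bot_le)
    exact (Λlim_anti hlt.le).trans (le_of_eq hs')

end KatokPressure

lemma exists_disjoint_subfamily_of_level {ι α : Type*} (B : ι → Set α) (lev : ι → ℕ) (t : Set ι)
    (hne : ∀ a ∈ t, (B a).Nonempty) :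
    ∃ u ⊆ t, u.PairwiseDisjoint B ∧ ∀ a ∈ t, ∃ b ∈ u, (B a ∩ B b).Nonempty ∧ lev b ≤ lev a := by
  obtain ⟨u, hu, hd, h⟩ := Vitali.exists_disjoint_subfamily_covering_enlargement B t
    (fun a => (1 / 2 : ℝ) ^ lev a) (3 / 2) (by norm_num) (fun _ _ => by positivity) 1
    (fun _ _ => pow_le_one₀ (by norm_num) (by norm_num)) hne
  refine ⟨u, hu, hd, fun a ha => ?_⟩
  obtain ⟨b, hb, h1, h2⟩ := h a ha
  refine ⟨b, hb, h1, not_lt.1 fun hlt => ?_⟩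
  have h3 : (1 / 2 : ℝ) ^ lev b ≤ (1 / 2) ^ (lev a + 1) :=
    pow_le_pow_of_le_one (by norm_num) (by norm_num) hlt
  have h4 : (0 : ℝ) < (1 / 2) ^ lev a := by positivity
  rw [pow_succ] at h3
  linarith

lemma tsum_image_le {α β : Type*} (f : β → ℝ≥0∞) (g : α → β) (u : Set α) :
    ∑' b : g '' u, f b ≤ ∑' a : u, f (g a) :=
  ENNReal.tsum_le_tsum_comp_of_surjective (imageFactorization_surjective (f := g) (s := u))
    fun b => f b

/-- If almost every point has infinitely many neutralized balls of at least exponential measure,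
then the Katok sums vanish for large exponents. -/
lemma exists_Λlim_eq_zero [MeasurableSpace X] [BorelSpace X] [CompactSpace X] {T : X → X}
    (hT : Continuous T) {φ : ℕ → X → ℝ} {ε M : ℝ} (hε : 0 < ε) (h : IsTame T φ ε M)
    {μ : Measure X} [IsProbabilityMeasure μ] {c : ℝ}
    (hμ : ∀ᵐ x ∂μ, ∃ᶠ n in atTop,
      ENNReal.ofReal (Real.exp (-n * c + φ n x)) ≤ μ (nBall T n ε x)) :
    ∃ t, ∀ δ ∈ Ioo (0 : ℝ) 1, Λlim T φ μ t ε δ = 0 := by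
  obtain ⟨κ, hκ⟩ := exists_four_le_exp hε
  obtain ⟨A, hA⟩ : ∃ A, A = c + M := ⟨_, rfl⟩
  obtain ⟨K, hK⟩ : ∃ K, K = Real.exp (κ * (A + 1)) := ⟨_, rfl⟩
  refine ⟨A + M + 1, fun δ hδ => ?_⟩
  have key : ∀ N : ℕ, ΛN T φ μ (A + M + 1) ε δ N ≤ ENNReal.ofReal (K * Real.exp (-N)) := by
    intro N
    let t : Set (X × ℕ) := {p | N + κ ≤ p.2 ∧
      ENNReal.ofReal (Real.exp (-p.2 * A)) ≤ μ (nBall T p.2 ε p.1)}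
    obtain ⟨u, hut, hd, hu⟩ := exists_disjoint_subfamily_of_level
      (fun p : X × ℕ => nBall T p.2 ε p.1) Prod.snd t
      (fun p _ => ⟨p.1, mem_nBall_self _ _ _ _⟩)
    have huc : u.Countable := hd.countable_of_isOpen (fun p _ => isOpen_nBall hT _ _ _)
      (fun p _ => ⟨p.1, mem_nBall_self _ _ _ _⟩)
    have hcov : ∀ᵐ x ∂μ, x ∈ ⋃ p ∈ (fun p : X × ℕ => (p.1, p.2 - κ)) '' u,
        nBall T p.2 ε p.1 := by
      filter_upwards [hμ] with x hx
      obtain ⟨n, hn, hx⟩ := frequently_atTop.1 hx (N + κ)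
      have hmem : (x, n) ∈ t := by
        refine ⟨hn, le_trans (ENNReal.ofReal_le_ofReal (Real.exp_le_exp.2 ?_)) hx⟩
        have h1 := neg_abs_le (φ n x)
        have h2 := h.abs_le n x
        rw [hA]
        linarith
      obtain ⟨⟨y, m⟩, hb, ⟨z, hz1, hz2⟩, hle⟩ := hu _ hmem
      simp only [mem_iUnion]
      refine ⟨_, mem_image_of_mem _ hb, ?_⟩
      exact mem_nBall_sub hκ hz2 (mem_nBall_comm.1 (nBall_anti hε hle _ hz1))
        (mem_nBall_self _ _ _ _) (mem_nBall_self _ _ _ _)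
    have := huc.to_subtype
    refine iInf₂_le_of_le ((fun p : X × ℕ => (p.1, p.2 - κ)) '' u) (huc.image _)
      (iInf₂_le_of_le ?_ ?_ ?_)
    · rintro _ ⟨p, hp, rfl⟩
      exact Nat.le_sub_of_add_le (hut hp).1
    · rw [(mem_ae_iff_prob_eq_one (isOpen_biUnion fun p _ => isOpen_nBall hT _ _ _).measurableSet).1
        hcov]
      simpa using hδ.1
    · calc ∑' p : (fun p : X × ℕ => (p.1, p.2 - κ)) '' u, wSup T φ (A + M + 1) ε p.1.2 p.1.1
          ≤ ∑' p : u, wSup T φ (A + M + 1) ε (p.1.2 - κ) p.1.1 := by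
            exact tsum_image_le (fun p : X × ℕ => wSup T φ (A + M + 1) ε p.2 p.1)
              (fun p : X × ℕ => (p.1, p.2 - κ)) u
        _ ≤ ∑' p : u, ENNReal.ofReal (K * Real.exp (-N)) * μ (nBall T p.1.2 ε p.1.1) := by
            refine ENNReal.tsum_le_tsum fun p => (h.wSup_le _ _ _).trans ?_
            obtain ⟨h1, h2⟩ := hut p.2
            refine le_trans ?_ (mul_le_mul_right h2 _)
            rw [hK, ← ENNReal.ofReal_mul (by positivity)]
            refine ENNReal.ofReal_le_ofReal ?_
            rw [← Real.exp_add, ← Real.exp_add]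
            refine Real.exp_le_exp.2 ?_
            have h3 : κ ≤ p.1.2 := (Nat.le_add_left _ _).trans h1
            have h4 : (N : ℝ) ≤ p.1.2 := by exact_mod_cast (Nat.le_add_right _ _).trans h1
            rw [Nat.cast_sub h3]
            linarith
        _ = ENNReal.ofReal (K * Real.exp (-N)) * μ (⋃ p ∈ u, nBall T p.2 ε p.1) := by
            rw [ENNReal.tsum_mul_left, measure_biUnion huc hd
              (fun p _ => (isOpen_nBall hT _ _ _).measurableSet)]
        _ ≤ _ := by
            exact mul_le_of_le_one_right' prob_le_one
  have hlim : Tendsto (fun N : ℕ => ENNReal.ofReal (K * Real.exp (-N))) atTop (𝓝 0) := by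
    have : Tendsto (fun N : ℕ => K * Real.exp (-N)) atTop (𝓝 (K * 0)) :=
      (Real.tendsto_exp_neg_atTop_nhds_zero.comp tendsto_natCast_atTop_atTop).const_mul K
    rw [mul_zero] at this
    simpa using ENNReal.tendsto_ofReal this
  refine le_antisymm (iSup_le fun N => ge_of_tendsto hlim ?_) bot_le
  filter_upwards [eventually_ge_atTop N] with N' hN'
  exact (ΛN_mono _ _ hN').trans (key N')

section UpperBound

variable [MeasurableSpace X] {T : X → X} {φ : ℕ → X → ℝ} {ε M s : ℝ} {μ : Measure X} {Z : Set X}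

lemma Λlim_le_Mlim [IsProbabilityMeasure μ] (hZ : μ Z = 1) {δ : ℝ} (hδ : 0 < δ) :
    Λlim T φ μ s ε δ ≤ Mlim T φ Z s ε := by
  refine iSup_mono fun N => le_iInf₂ fun D hD => le_iInf₂ fun hN hc => ?_
  refine iInf₂_le_of_le D hD (iInf₂_le_of_le hN ?_ le_rfl)
  refine lt_of_lt_of_le ?_ (hZ.symm.le.trans (measure_mono hc))
  simpa using hδ

/-- If the covering sums with exponent `s` vanish, then almost every point has infinitely many
neutralized balls of measure at least `e^{-ns + φ_n}`. -/
lemma frequently_le_measure_nBall [BorelSpace X] [IsProbabilityMeasure μ] (hε : 0 < ε)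
    (h : IsTame T φ ε M) (hZm : MeasurableSet Z) (hZ : μ Z = 1) (hs : Mlim T φ Z s ε = 0) :
    ∀ᵐ x ∂μ, ∃ᶠ n in atTop,
      ENNReal.ofReal (Real.exp (-n * s + φ n x)) ≤ μ (nBall T n ε x) := by
  obtain ⟨κ, hκ⟩ := exists_four_le_exp hε
  let A : ℕ → Set X := fun N =>
    {x ∈ Z | ∀ n ≥ N, μ (nBall T n ε x) < ENNReal.ofReal (Real.exp (-n * s + φ n x))}
  have hA : ∀ N, μ (A N) = 0 := by
    intro N
    have hMN : MN T φ Z s ε (N + κ) = 0 := le_antisymm ((le_iSup _ (N + κ)).trans hs.le) bot_le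
    set C : ℝ≥0∞ := ENNReal.ofReal (Real.exp (κ * (s + M))) with hC
    have hC0 : C ≠ 0 := (ENNReal.ofReal_pos.2 (Real.exp_pos _)).ne'
    have hball : ∀ (n : ℕ) (x : X), N + κ ≤ n →
        μ (nBall T n ε x ∩ A N) ≤ C * wSup T φ s ε n x := by
      intro n x hn
      rcases (nBall T n ε x ∩ A N).eq_empty_or_nonempty with h0 | ⟨z, hz, hzA⟩
      · simp [h0]
      refine (measure_mono (inter_subset_left.trans (nBall_subset_sub hκ hz))).trans ?_
      refine (hzA.2 _ (Nat.le_sub_of_add_le hn)).le.trans ?_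
      rw [hC, wSup, ← ENNReal.ofReal_mul (Real.exp_pos _).le, ← Real.exp_add]
      refine ENNReal.ofReal_le_ofReal (Real.exp_le_exp.2 ?_)
      have h1 := (le_abs_self _).trans (h.abs_sub_le n κ z)
      have h2 : φ n z ≤ sSup (φ n '' nBall T n ε x) := le_csSup (h.bddAbove n x) ⟨z, hz, rfl⟩
      rw [Nat.cast_sub ((Nat.le_add_left _ _).trans hn)]
      linarith
    have key : μ (A N) / C ≤ MN T φ Z s ε (N + κ) := by
      refine le_iInf₂ fun D hD => le_iInf₂ fun hN hc => ?_
      refine ENNReal.div_le_of_le_mul' ?_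
      have := hD.to_subtype
      calc μ (A N) ≤ μ (⋃ p : D, nBall T p.1.2 ε p.1.1 ∩ A N) := by
            refine measure_mono fun x hx => ?_
            obtain ⟨p, hp, hxp⟩ := mem_iUnion₂.1 (hc hx.1)
            exact mem_iUnion.2 ⟨⟨p, hp⟩, hxp, hx⟩
        _ ≤ ∑' p : D, μ (nBall T p.1.2 ε p.1.1 ∩ A N) := measure_iUnion_le _
        _ ≤ ∑' p : D, C * wSup T φ s ε p.1.2 p.1.1 :=
            ENNReal.tsum_le_tsum fun p => hball _ _ (hN _ p.2)
        _ = C * ∑' p : D, wSup T φ s ε p.1.2 p.1.1 := ENNReal.tsum_mul_left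
    rw [hMN, nonpos_iff_eq_zero, ENNReal.div_eq_zero_iff] at key
    exact key.resolve_right ENNReal.ofReal_ne_top
  filter_upwards [(mem_ae_iff_prob_eq_one hZm).2 hZ,
    ae_all_iff.2 fun N => measure_eq_zero_iff_ae_notMem.1 (hA N)]
    with x hxZ hx
  refine frequently_atTop.2 fun N => ?_
  by_contra! hcon
  exact hx N ⟨hxZ, hcon⟩

end UpperBound

/-- A finite packing problem has a solution for which every point lies in a saturated set. -/
lemma exists_saturated_packing {α ι : Type*} [Fintype α] [Finite ι] (U : ι → Set α) (g : ι → ℝ)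
    (hg : ∀ i, 0 ≤ g i) (hU : ∀ x, ∃ i, x ∈ U i) :
    ∃ w : α → ℝ, (∀ x, 0 ≤ w x) ∧ (∀ i, ∑ x, (U i).indicator w x ≤ g i) ∧
      ∀ x, ∃ i, x ∈ U i ∧ ∑ x, (U i).indicator w x = g i := by
  classical
  let K : Set (α → ℝ) := {w | (∀ x, 0 ≤ w x) ∧ ∀ i, ∑ x, (U i).indicator w x ≤ g i}
  have hcont : ∀ i, Continuous fun w : α → ℝ => ∑ x, (U i).indicator w x := by
    intro i
    refine continuous_finsetSum _ fun x _ => ?_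
    by_cases hx : x ∈ U i
    · simpa [hx] using continuous_apply x
    · simpa [hx] using continuous_const
  have hclosed : IsClosed K := by
    have : K = (⋂ x, {w | 0 ≤ w x}) ∩ ⋂ i, {w | ∑ x, (U i).indicator w x ≤ g i} := by
      ext w
      simp [K]
    rw [this]
    exact (isClosed_iInter fun x => isClosed_le continuous_const (continuous_apply x)).inter
      (isClosed_iInter fun i => isClosed_le (hcont i) continuous_const)
  choose i₀ hi₀ using hU
  have hsub : K ⊆ univ.pi fun x => Icc 0 (g (i₀ x)) := by
    rintro w ⟨h0, h1⟩ x -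
    refine ⟨h0 x, le_trans ?_ (h1 (i₀ x))⟩
    rw [← indicator_of_mem (hi₀ x) w]
    exact Finset.single_le_sum (f := fun x' => (U (i₀ x)).indicator w x')
      (fun y _ => indicator_nonneg (fun y _ => h0 y) y) (Finset.mem_univ x)
  have hK : IsCompact K := (isCompact_univ_pi fun x => isCompact_Icc).of_isClosed_subset hclosed hsub
  obtain ⟨w, hw, hmax⟩ := hK.exists_isMaxOn (f := fun w : α → ℝ => ∑ x, w x)
    ⟨0, fun x => le_rfl, fun i => by simpa using hg i⟩
    (continuous_finsetSum _ fun x _ => continuous_apply x).continuousOn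
  refine ⟨w, hw.1, hw.2, fun x => ?_⟩
  by_contra! hx
  have hev : ∀ᶠ δ in 𝓝[>] (0 : ℝ), ∀ i, x ∈ U i → δ < g i - ∑ x, (U i).indicator w x := by
    refine eventually_all.2 fun i => ?_
    by_cases hi : x ∈ U i
    · have : 0 < g i - ∑ x, (U i).indicator w x :=
        sub_pos.2 (lt_of_le_of_ne (hw.2 i) (hx i hi))
      filter_upwards [Ioo_mem_nhdsGT this] with δ hδ _ using hδ.2
    · exact Eventually.of_forall fun δ h => absurd h hi
  obtain ⟨δ, hδ, hδ0⟩ := (hev.and self_mem_nhdsWithin).exists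
  have hδ0 : 0 < δ := hδ0
  have hmem : w + Pi.single x δ ∈ K := by
    refine ⟨fun y => add_nonneg (hw.1 y) ?_, fun i => ?_⟩
    · by_cases hy : y = x
      · subst hy
        simpa using hδ0.le
      · simp [hy]
    · rw [indicator_add']
      simp only [Pi.add_apply, Finset.sum_add_distrib]
      by_cases hi : x ∈ U i
      · have : ∑ y, (U i).indicator (Pi.single x δ) y ≤ δ := by
          rw [Finset.sum_eq_single x (fun y _ hy => by simp [indicator, hy]) (by simp)]
          simp [hi]
        linarith [hδ i hi]
      · rw [Finset.sum_eq_zero (f := fun y => (U i).indicator (Pi.single x δ) y)]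
        · simpa using hw.2 i
        · intro y _
          by_cases hy : y = x
          · subst hy
            simp [hi]
          · simp [indicator, hy]
  have := isMaxOn_iff.1 hmax _ hmem
  simp only [Pi.add_apply, Finset.sum_add_distrib, Finset.sum_pi_single', Finset.mem_univ,
    if_true] at this
  linarith

lemma sum_indicator_le_of_pairwiseDisjoint {α ι : Type*} {U : ι → Set α} {v : Finset ι}
    (hd : (v : Set ι).PairwiseDisjoint U) {w : α → ℝ} (hw : ∀ x, 0 ≤ w x) (x : α) :
    ∑ i ∈ v, (U i).indicator w x ≤ w x := by
  by_cases hx : ∃ i ∈ v, x ∈ U i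
  · obtain ⟨i, hi, hxi⟩ := hx
    rw [Finset.sum_eq_single_of_mem i hi fun j hj hji =>
      indicator_of_notMem (fun hxj => disjoint_left.1 (hd hj hi hji) hxj hxi) _,
      indicator_of_mem hxi]
  · push Not at hx
    rw [Finset.sum_eq_zero fun i hi => indicator_of_notMem (hx i hi) _]
    exact hw x

/-- A finite weighted sum of Dirac masses, normalized. -/
lemma exists_prob_of_weights [MeasurableSpace X] [BorelSpace X] {Z : Set X} (hZ : MeasurableSet Z)
    {F : Finset X} (hF : ∀ x ∈ F, x ∈ Z) {w : F → ℝ} (hw : ∀ x, 0 ≤ w x)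
    (hW : 0 < ∑ x, w x) :
    ∃ μ : Measure X, IsProbabilityMeasure μ ∧ μ Z = 1 ∧ ∀ U : Set X, MeasurableSet U →
      μ U = ENNReal.ofReal ((∑ x, ((↑) ⁻¹' U : Set F).indicator w x) / ∑ x, w x) := by
  set W := ∑ x, w x
  let μ : Measure X := ∑ x : F, ENNReal.ofReal (w x / W) • Measure.dirac (x : X)
  have key : ∀ U : Set X, MeasurableSet U →
      μ U = ENNReal.ofReal ((∑ x, ((↑) ⁻¹' U : Set F).indicator w x) / W) := by
    intro U hU
    rw [Finset.sum_div, ENNReal.ofReal_sum_of_nonneg fun x _ =>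
      div_nonneg (indicator_nonneg (fun y _ => hw y) x) hW.le]
    simp only [μ, Measure.coe_finsetSum, Finset.sum_apply, Measure.smul_apply, smul_eq_mul]
    refine Finset.sum_congr rfl fun x _ => ?_
    rw [Measure.dirac_apply' _ hU]
    by_cases hx : (x : X) ∈ U
    · simp [hx]
    · simp [hx]
  have hone : ∀ U : Set X, MeasurableSet U → (∀ x ∈ F, x ∈ U) → μ U = 1 := by
    intro U hU hFU
    have : ((↑) ⁻¹' U : Set F) = univ := eq_univ_of_forall fun x => hFU x x.2
    rw [key U hU, this, indicator_univ, div_self hW.ne', ENNReal.ofReal_one]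
  exact ⟨μ, ⟨hone univ MeasurableSet.univ fun _ _ => mem_univ _⟩, hone Z hZ hF, key⟩

/-- For every finite horizon `L` there is a probability measure on `Z` whose values on
neutralized Bowen balls of orders in `[N, L]` are bounded by a uniform multiple of the
weights. -/
lemma exists_prob_le_weights [CompactSpace X] [MeasurableSpace X] [BorelSpace X] {T : X → X}
    (hT : Continuous T) {φ : ℕ → X → ℝ} {ε M s s' : ℝ} {Z : Set X} (hZ : IsCompact Z)
    (hε : 0 < ε) (h : IsTame T φ ε M) {κ : ℕ} (hκ : 4 ≤ Real.exp (κ * ε)) (hs : s' < s) {N : ℕ}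
    (hN : MN T φ Z s ε N ≠ 0) {F : ℕ → Finset X}
    (hF : ∀ n x, ∃ y ∈ F n, x ∈ nBall T n ε y) :
    ∃ C > 0, ∀ L, N + 2 * κ ≤ L → ∃ μ : Measure X, IsProbabilityMeasure μ ∧ μ Z = 1 ∧
      ∀ n ∈ Icc (N + 2 * κ) L, ∀ y ∈ F n,
        μ (nBall T (n - κ) ε y) ≤ ENNReal.ofReal (C * Real.exp (-n * s' + φ n y)) := by
  obtain ⟨Cη, hCη, hdist⟩ := h.distortion (s - s') (sub_pos.2 hs)
  obtain ⟨C₁, hC₁⟩ : ∃ C₁, C₁ = Real.exp (2 * κ * (s' + M) + Cη) := ⟨_, rfl⟩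
  have hC₁0 : 0 < C₁ := hC₁ ▸ Real.exp_pos _
  obtain ⟨b, hb0, hb⟩ : ∃ b : ℝ, 0 < b ∧ ENNReal.ofReal b ≤ MN T φ Z s ε N := by
    refine ⟨(min (MN T φ Z s ε N) 1).toReal, ENNReal.toReal_pos ?_ ?_, ?_⟩
    · simpa using hN
    · exact ne_top_of_le_ne_top one_ne_top (min_le_right _ _)
    · rw [ENNReal.ofReal_toReal (ne_top_of_le_ne_top one_ne_top (min_le_right _ _))]
      exact min_le_left _ _
  refine ⟨C₁ / b, by positivity, fun L hL => ?_⟩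
  obtain ⟨F₀, hF₀Z, hF₀⟩ := hZ.elim_nhds_subcover (fun x => nBall T L ε x)
    fun x _ => (isOpen_nBall hT L ε x).mem_nhds (mem_nBall_self T L ε x)
  let ι := (n : Finset.Icc (N + 2 * κ) L) × F n
  let B : ι → Set X := fun i => nBall T (i.1 - κ) ε i.2
  let g : ι → ℝ := fun i => Real.exp (-(i.1 : ℕ) * s' + φ i.1 i.2)
  obtain ⟨w, hw0, hwg, hsat⟩ := exists_saturated_packing
    (fun i : ι => ((↑) ⁻¹' B i : Set F₀)) g (fun i => (Real.exp_pos _).le) (by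
      intro x
      obtain ⟨y, hy, hxy⟩ := hF L x
      exact ⟨⟨⟨L, Finset.mem_Icc.2 ⟨hL, le_rfl⟩⟩, ⟨y, hy⟩⟩,
        nBall_anti hε (Nat.sub_le _ _) _ hxy⟩)
  obtain ⟨u, hut, hud, hu⟩ := exists_disjoint_subfamily_of_level B (fun i => (i.1 : ℕ))
    {i | ∑ x, ((↑) ⁻¹' B i : Set F₀).indicator w x = g i}
    (fun i _ => ⟨i.2, mem_nBall_self _ _ _ _⟩)
  have hcov : Z ⊆ ⋃ p ∈ (fun i : ι => ((i.2 : X), (i.1 : ℕ) - κ - κ)) '' u,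
      nBall T p.2 ε p.1 := by
    intro z hz
    obtain ⟨x, hx, hzx⟩ := mem_iUnion₂.1 (hF₀ hz)
    obtain ⟨i, hi, hsi⟩ := hsat ⟨x, hx⟩
    obtain ⟨j, hj, ⟨v, hvi, hvj⟩, hle⟩ := hu i hsi
    refine mem_iUnion₂.2 ⟨_, mem_image_of_mem _ hj, ?_⟩
    have hle' : (j.1 : ℕ) - κ ≤ i.1 - κ := Nat.sub_le_sub_right hle κ
    have hjL : (j.1 : ℕ) - κ ≤ L := (Nat.sub_le _ _).trans (Finset.mem_Icc.1 j.1.2).2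
    exact mem_nBall_sub hκ hvj (mem_nBall_comm.1 (nBall_anti hε hle' _ hvi))
      (nBall_anti hε hle' _ hi) (nBall_anti hε hjL _ hzx)
  have hweight : ∀ i : ι, wSup T φ s ε ((i.1 : ℕ) - κ - κ) i.2 ≤ ENNReal.ofReal (C₁ * g i) := by
    intro i
    refine (wSup_le (hdist _ _) s).trans ?_
    have hi : κ + κ ≤ (i.1 : ℕ) := by
      have := (Finset.mem_Icc.1 i.1.2).1
      omega
    rw [hC₁, ← Real.exp_add]
    refine ENNReal.ofReal_le_ofReal (Real.exp_le_exp.2 ?_)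
    have h1 := (le_abs_self _).trans (h.abs_sub_le i.1 (κ + κ) i.2)
    rw [Nat.sub_sub, Nat.cast_sub hi]
    push_cast at h1 ⊢
    nlinarith
  have hsum : b ≤ C₁ * ∑ x, w x := by
    classical
    have hle : MN T φ Z s ε N ≤ ENNReal.ofReal (C₁ * ∑ x, w x) := by
      calc MN T φ Z s ε N
          ≤ ∑' p : (fun i : ι => ((i.2 : X), (i.1 : ℕ) - κ - κ)) '' u,
              wSup T φ s ε p.1.2 p.1.1 := by
            refine iInf₂_le_of_le _ (u.to_countable.image _) (iInf₂_le_of_le ?_ hcov le_rfl)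
            rintro _ ⟨i, -, rfl⟩
            have := (Finset.mem_Icc.1 i.1.2).1
            simp only
            omega
        _ ≤ ∑' i : u, wSup T φ s ε ((i.1.1 : ℕ) - κ - κ) i.1.2 :=
            tsum_image_le (fun p : X × ℕ => wSup T φ s ε p.2 p.1)
              (fun i : ι => ((i.2 : X), (i.1 : ℕ) - κ - κ)) u
        _ ≤ ∑' i : u, ENNReal.ofReal (C₁ * g i) := ENNReal.tsum_le_tsum fun i => hweight i
        _ = ENNReal.ofReal (∑ i ∈ u.toFinset, C₁ * g i) := by
            rw [tsum_fintype, ENNReal.ofReal_sum_of_nonneg fun i _ =>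
              mul_nonneg hC₁0.le (Real.exp_pos _).le]
            exact Finset.sum_set_coe (f := fun i : ι => ENNReal.ofReal (C₁ * g i)) u
        _ ≤ ENNReal.ofReal (C₁ * ∑ x, w x) := by
            refine ENNReal.ofReal_le_ofReal ?_
            rw [← Finset.mul_sum]
            refine mul_le_mul_of_nonneg_left ?_ hC₁0.le
            rw [← Finset.sum_congr rfl fun i hi => hut (mem_toFinset.1 hi), Finset.sum_comm]
            refine Finset.sum_le_sum fun x _ =>
              sum_indicator_le_of_pairwiseDisjoint (fun i hi j hj hij => ?_) hw0 x
            exact (hud (mem_toFinset.1 hi) (mem_toFinset.1 hj) hij).preimage _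
    have := hb.trans hle
    rwa [ENNReal.ofReal_le_ofReal_iff (mul_nonneg hC₁0.le (Finset.sum_nonneg fun x _ => hw0 x))]
      at this
  have hW : 0 < ∑ x, w x := pos_of_mul_pos_right (hb0.trans_le hsum) hC₁0.le
  obtain ⟨μ, hμ, hμZ, hμU⟩ := exists_prob_of_weights hZ.isClosed.measurableSet hF₀Z hw0 hW
  refine ⟨μ, hμ, hμZ, fun n hn y hy => ?_⟩
  rw [hμU _ (isOpen_nBall hT _ _ _).measurableSet]
  refine ENNReal.ofReal_le_ofReal ?_
  have h1 := hwg ⟨⟨n, Finset.mem_Icc.2 hn⟩, ⟨y, hy⟩⟩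
  rw [div_le_iff₀ hW]
  refine h1.trans ?_
  have h2 : 1 ≤ C₁ / b * ∑ x, w x := by
    rw [div_mul_eq_mul_div, le_div_iff₀ hb0]
    linarith
  have h3 := le_mul_of_one_le_left (Real.exp_pos (-(n : ℝ) * s' + φ n y)).le h2
  simp only [g]
  linarith

section ExtremeMeasures

open BoundedContinuousFunction Function

lemma isClosed_setOf_measure_le {X : Type*} [TopologicalSpace X] [HasOuterApproxClosed X]
    [MeasurableSpace X] [OpensMeasurableSpace X] {U : Set X} (hU : IsOpen U) (c : ℝ≥0∞) :
    IsClosed {ν : ProbabilityMeasure X | (ν : Measure X) U ≤ c} := by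
  refine isClosed_iff_ultrafilter.2 fun ν u hu hc => ?_
  have h1 := ProbabilityMeasure.le_liminf_measure_open_of_tendsto
    (show Tendsto (fun ν' : ProbabilityMeasure X => ν') u (𝓝 ν) from hu) hU
  exact h1.trans (liminf_le_of_frequently_le' (Eventually.frequently hc))

/-- A set of positive measure without atoms contains arbitrarily many disjoint subsets of positive
measure. -/
lemma exists_pairwise_disjoint_measure_ne_zero {X : Type*} [TopologicalSpace X] [T2Space X]
    [SecondCountableTopology X] [MeasurableSpace X] [BorelSpace X] {μ : Measure X} (m : ℕ) :
    ∀ {A : Set X}, MeasurableSet A → μ A ≠ 0 → (∀ x ∈ A, μ {x} = 0) →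
      ∃ B : Fin m → Set X, (∀ j, MeasurableSet (B j)) ∧ (∀ j, B j ⊆ A) ∧ (∀ j, μ (B j) ≠ 0) ∧
        Pairwise (Disjoint on B) := by
  induction m with
  | zero => exact fun _ _ _ => ⟨fun _ => ∅, fun j => j.elim0, fun j => j.elim0, fun j => j.elim0,
      fun j => j.elim0⟩
  | succ m ih =>
    intro A hA hA0 hatom
    obtain ⟨x, hx, hxpos⟩ := exists_mem_forall_mem_nhdsWithin_pos_measure hA0
    have hA' : μ (A \ {x}) ≠ 0 := by
      rwa [measure_sdiff_null (hatom x hx)]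
    obtain ⟨y, hy, hypos⟩ := exists_mem_forall_mem_nhdsWithin_pos_measure hA'
    obtain ⟨V, W, hV, hW, hxV, hyW, hVW⟩ := t2_separation (Ne.symm hy.2)
    have hyA : μ (A ∩ W) ≠ 0 := by
      refine ((hypos _ (inter_mem_nhdsWithin _ (hW.mem_nhds hyW))).trans_le
        (measure_mono ?_)).ne'
      exact inter_subset_inter_left _ sdiff_subset
    obtain ⟨B, hB, hBA, hB0, hBd⟩ := ih (hA.inter hW.measurableSet) hyA fun z hz => hatom z hz.1
    refine ⟨Fin.cons (A ∩ V) B, ?_, ?_, ?_, ?_⟩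
    · exact Fin.cases (hA.inter hV.measurableSet) hB
    · exact Fin.cases inter_subset_left fun j => (hBA j).trans inter_subset_left
    · exact Fin.cases (hxpos _ (inter_mem_nhdsWithin _ (hV.mem_nhds hxV))).ne' hB0
    · have hdis : ∀ j, Disjoint (A ∩ V) (B j) := fun j =>
        hVW.mono inter_subset_right ((hBA j).trans inter_subset_right)
      intro i j hij
      induction i using Fin.cases with
      | zero =>
        induction j using Fin.cases with
        | zero => exact absurd rfl hij
        | succ j => exact hdis j
      | succ i =>
        induction j using Fin.cases with
        | zero => exact (hdis i).symm
        | succ j => exact hBd (fun h => hij (congrArg _ h))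

lemma exists_bounded_relation {ι : Type*} [Finite ι] {m : ℕ} (hm : Nat.card ι < m)
    (v : Fin m → ι → ℝ) :
    ∃ a : Fin m → ℝ, a ≠ 0 ∧ (∀ j, |a j| ≤ 1) ∧ ∀ i, ∑ j, a j * v j i = 0 := by
  have := Fintype.ofFinite ι
  have hker : (Fintype.linearCombination ℝ v).ker ≠ ⊥ := by
    refine LinearMap.ker_ne_bot_of_finrank_lt ?_
    simpa [Nat.card_eq_fintype_card] using hm
  obtain ⟨a, ha, ha0⟩ := Submodule.exists_mem_ne_zero_of_ne_bot hker
  refine ⟨‖a‖⁻¹ • a, by simpa using ha0, fun j => ?_, fun i => ?_⟩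
  · have h1 := norm_le_pi_norm a j
    rw [Pi.smul_apply, smul_eq_mul, abs_mul, abs_of_nonneg (inv_nonneg.2 (norm_nonneg a)),
      inv_mul_le_one₀ (norm_pos_iff.2 ha0)]
    exact h1
  · have h1 := congrFun (LinearMap.mem_ker.1 ha) i
    simp only [Fintype.linearCombination_apply, Finset.sum_apply, Pi.smul_apply, smul_eq_mul,
      Pi.zero_apply] at h1
    simp only [Pi.smul_apply, smul_eq_mul, mul_assoc, ← Finset.mul_sum, h1, mul_zero]

/-- Multiplying the density on disjoint sets `B j` by `1 + a j`. -/
lemma exists_perturbation {X : Type*} [MeasurableSpace X] (μ : Measure X) [IsFiniteMeasure μ]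
    {m : ℕ} {B : Fin m → Set X} (hB : ∀ j, MeasurableSet (B j)) (hd : Pairwise (Disjoint on B))
    {a : Fin m → ℝ} (ha : ∀ j, |a j| ≤ 1) :
    ∃ ν : Measure X, IsFiniteMeasure ν ∧ ν ≤ (2 : ℝ≥0∞) • μ ∧ ∀ S, MeasurableSet S →
      ν.real S = μ.real S + ∑ j, a j * μ.real (S ∩ B j) := by
  have hdec : ∀ S, μ.restrict (⋃ j, B j)ᶜ S + ∑ j, μ.restrict (B j) S = μ S := by
    intro S
    have h1 : μ.restrict (⋃ j, B j) = ∑ j, μ.restrict (B j) := by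
      rw [Measure.restrict_iUnion hd hB, Measure.sum_fintype]
    have h2 := Measure.restrict_compl_add_restrict (μ := μ) (MeasurableSet.iUnion hB)
    rw [h1] at h2
    conv_rhs => rw [← h2]
    simp
  let ν : Measure X := μ.restrict (⋃ j, B j)ᶜ + ∑ j, ENNReal.ofReal (1 + a j) • μ.restrict (B j)
  have hν2 : ν ≤ (2 : ℝ≥0∞) • μ := by
    refine Measure.le_iff'.2 fun S => ?_
    have h1 : ∀ j, ENNReal.ofReal (1 + a j) ≤ 2 := fun j => by
      rw [ENNReal.ofReal_le_iff_le_toReal (by simp)]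
      simpa using by linarith [(abs_le.1 (ha j)).2]
    simp only [ν, Measure.add_apply, Measure.coe_finsetSum, Finset.sum_apply, Measure.smul_apply,
      smul_eq_mul]
    rw [← hdec S, mul_add, Finset.mul_sum]
    gcongr with j
    · exact le_mul_of_one_le_left' one_le_two
    · exact h1 j
  have hfin : IsFiniteMeasure ν := by
    refine ⟨(Measure.le_iff'.1 hν2 univ).trans_lt ?_⟩
    exact ENNReal.mul_lt_top (by simp) (measure_lt_top μ univ)
  refine ⟨ν, hfin, hν2, fun S hS => ?_⟩
  have h0 : ∀ j, 0 ≤ 1 + a j := fun j => by linarith [(abs_le.1 (ha j)).1]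
  have e1 : ν.real S = (μ.restrict (⋃ j, B j)ᶜ).real S +
      ∑ j, (1 + a j) * (μ.restrict (B j)).real S := by
    simp only [ν, Measure.real, Measure.add_apply, Measure.coe_finsetSum, Finset.sum_apply,
      Measure.smul_apply, smul_eq_mul]
    rw [ENNReal.toReal_add (measure_ne_top _ _), ENNReal.toReal_sum]
    · simp [h0]
    · exact fun j _ => ENNReal.mul_ne_top ENNReal.ofReal_ne_top (measure_ne_top _ _)
    · exact ENNReal.sum_ne_top.2 fun j _ =>
        ENNReal.mul_ne_top ENNReal.ofReal_ne_top (measure_ne_top _ _)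
  have e2 : μ.real S = (μ.restrict (⋃ j, B j)ᶜ).real S + ∑ j, (μ.restrict (B j)).real S := by
    simp only [Measure.real]
    rw [← hdec S, ENNReal.toReal_add (measure_ne_top _ _)
      (ENNReal.sum_ne_top.2 fun j _ => measure_ne_top _ _),
      ENNReal.toReal_sum fun j _ => measure_ne_top _ _]
  rw [e1, e2, add_assoc, ← Finset.sum_add_distrib]
  congr 1
  refine Finset.sum_congr rfl fun j _ => ?_
  rw [measureReal_restrict_apply hS]
  ring

end ExtremeMeasures

section Extremality

open BoundedContinuousFunction Function

variable {X : Type*} [MetricSpace X] [CompactSpace X] [MeasurableSpace X] [BorelSpace X]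

lemma exists_extreme_probabilityMeasure {K : Set (ProbabilityMeasure X)} (hK : IsClosed K)
    (hne : K.Nonempty) :
    ∃ μ ∈ K, ∀ ν₁ ∈ K, ∀ ν₂ ∈ K,
      (ν₁ + ν₂ : Measure X) = (2 : ℝ≥0∞) • (μ : Measure X) → ν₁ = μ := by
  let Ψ : ProbabilityMeasure X → (X →ᵇ ℝ) → ℝ := fun μ f => ∫ x, f x ∂(μ : Measure X)
  have hΨ : Continuous Ψ := continuous_pi fun f =>
    ProbabilityMeasure.continuous_integral_boundedContinuousFunction f
  obtain ⟨p, hp⟩ := (hK.isCompact.image hΨ).extremePoints_nonempty (hne.image Ψ)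
  obtain ⟨⟨μ, hμ, rfl⟩, hext⟩ := mem_extremePoints_iff_left.1 hp
  refine ⟨μ, hμ, fun ν₁ h₁ ν₂ h₂ hadd => ?_⟩
  have hseg : Ψ μ ∈ openSegment ℝ (Ψ ν₁) (Ψ ν₂) := by
    refine ⟨1 / 2, 1 / 2, by norm_num, by norm_num, by norm_num, funext fun f => ?_⟩
    have h := congrArg (fun ν : Measure X => ∫ x, f x ∂ν) hadd
    simp only [integral_add_measure (f.integrable _) (f.integrable _), integral_smul_measure] at h
    simp only [Pi.add_apply, Pi.smul_apply, smul_eq_mul, Ψ]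
    simp at h
    linarith
  have := hext _ (mem_image_of_mem Ψ h₁) _ (mem_image_of_mem Ψ h₂) hseg
  exact ProbabilityMeasure.toMeasure_injective
    (ext_of_forall_integral_eq_of_IsFiniteMeasure fun f => congrFun this f)

/-- An extreme point of the set of probability measures satisfying `μ (U i) ≤ c i` for all `i`
almost saturates infinitely many constraints at almost every point which is not an atom. -/
lemma exists_prob_saturated {ι : Type*} (lev : ι → ℕ) (hfin : ∀ n, {i | lev i ≤ n}.Finite)
    {U : ι → Set X} (hU : ∀ i, IsOpen (U i)) (c : ι → ℝ≥0∞)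
    (hex : ∀ L, ∃ μ : Measure X, IsProbabilityMeasure μ ∧ ∀ i, lev i ≤ L → μ (U i) ≤ c i) :
    ∃ μ : Measure X, IsProbabilityMeasure μ ∧ (∀ i, μ (U i) ≤ c i) ∧
      ∀ᵐ x ∂μ, μ {x} = 0 → ∀ n, ∃ i, n ≤ lev i ∧ x ∈ U i ∧ c i < 2 * μ (U i) := by
  let K : ℕ → Set (ProbabilityMeasure X) := fun L =>
    ⋂ i ∈ {i | lev i ≤ L}, {ν | (ν : Measure X) (U i) ≤ c i}
  have hKclosed : ∀ L, IsClosed (K L) := fun L =>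
    isClosed_biInter fun i _ => isClosed_setOf_measure_le (hU i) (c i)
  have hKne : (⋂ L, K L).Nonempty := by
    refine IsCompact.nonempty_iInter_of_sequence_nonempty_isCompact_isClosed K (fun L => ?_)
      (fun L => ?_) (hKclosed 0).isCompact hKclosed
    · exact biInter_subset_biInter_left fun i (hi : lev i ≤ L) => hi.trans (Nat.le_succ L)
    · obtain ⟨μ, hμ, hμU⟩ := hex L
      exact ⟨⟨μ, hμ⟩, mem_iInter₂.2 hμU⟩
  have hmemK : ∀ ν : ProbabilityMeasure X, ν ∈ ⋂ L, K L ↔ ∀ i, (ν : Measure X) (U i) ≤ c i :=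
    fun ν => ⟨fun h i => mem_iInter₂.1 (mem_iInter.1 h (lev i)) i (le_refl (lev i)),
      fun h => mem_iInter.2 fun L => mem_iInter₂.2 fun i _ => h i⟩
  obtain ⟨μ, hμK, hμext⟩ := exists_extreme_probabilityMeasure (isClosed_iInter hKclosed) hKne
  rw [hmemK] at hμK
  refine ⟨μ, inferInstance, hμK, ?_⟩
  let A : ℕ → Set X := fun n =>
    {x | (μ : Measure X) {x} = 0 ∧
      ∀ i, n ≤ lev i → x ∈ U i → 2 * (μ : Measure X) (U i) ≤ c i}
  suffices hA : ∀ n, (μ : Measure X) (A n) = 0 by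
    filter_upwards [ae_all_iff.2 fun n => measure_eq_zero_iff_ae_notMem.1 (hA n)] with x hx hx0 n
    by_contra! hcon
    exact hx n ⟨hx0, fun i hi hxi => hcon i hi hxi⟩
  intro n
  by_contra hAn
  have hAmeas : MeasurableSet (A n) := by
    have h1 : MeasurableSet {x | (μ : Measure X) {x} = 0} := by
      have := Measure.countable_meas_pos_of_disjoint_iUnion (μ := (μ : Measure X))
        (As := fun x : X => {x}) (fun x => measurableSet_singleton x)
        (fun x y hxy => disjoint_singleton.2 hxy)
      convert this.measurableSet.compl using 1
      ext x
      simp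
    have h2 : IsClosed {x | ∀ i, n ≤ lev i → x ∈ U i → 2 * (μ : Measure X) (U i) ≤ c i} := by
      have : {x | ∀ i, n ≤ lev i → x ∈ U i → 2 * (μ : Measure X) (U i) ≤ c i} =
          ⋂ i ∈ {i | n ≤ lev i ∧ ¬ 2 * (μ : Measure X) (U i) ≤ c i}, (U i)ᶜ := by
        ext x
        simp only [mem_ofPred_eq, mem_iInter₂, mem_compl_iff, and_imp]
        exact forall_congr' fun i => imp_congr_right fun _ => not_imp_not.symm
      rw [this]
      exact isClosed_biInter fun i _ => (hU i).isClosed_compl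
    exact h1.inter h2.measurableSet
  have := (hfin n).to_subtype
  obtain ⟨B, hB, hBA, hB0, hBd⟩ := exists_pairwise_disjoint_measure_ne_zero
    (μ := (μ : Measure X)) (Nat.card (Option {i | lev i ≤ n}) + 1) hAmeas hAn fun x hx => hx.1
  obtain ⟨a, ha0, ha1, ha⟩ := exists_bounded_relation (Nat.lt_succ_self _)
    (fun j (i : Option {i | lev i ≤ n}) =>
      (μ : Measure X).real ((i.elim univ fun i => U i) ∩ B j))
  have hfeas : ∀ a : Fin (Nat.card (Option {i | lev i ≤ n}) + 1) → ℝ, (∀ j, |a j| ≤ 1) →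
      (∀ i : Option {i | lev i ≤ n},
        ∑ j, a j * (μ : Measure X).real ((i.elim univ fun i => U i) ∩ B j) = 0) →
      ∃ ν ∈ ⋂ L, K L, ∀ S, MeasurableSet S → (ν : Measure X).real S =
        (μ : Measure X).real S + ∑ j, a j * (μ : Measure X).real (S ∩ B j) := by
    intro a ha1 ha
    obtain ⟨ν, hν, hν2, hνS⟩ := exists_perturbation (μ : Measure X) hB hBd ha1
    have hν1 : IsProbabilityMeasure ν := by
      have h0 := ha none
      have h1 := hνS univ MeasurableSet.univ
      simp only [Option.elim_none] at h0
      rw [h0, add_zero, probReal_univ (μ := (μ : Measure X))] at h1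
      exact ⟨by rw [← ENNReal.toReal_eq_one_iff]; exact h1⟩
    have heq : ∀ i, ∑ j, a j * (μ : Measure X).real (U i ∩ B j) = 0 → ν (U i) ≤ c i := by
      intro i hi
      have h1 := hνS _ (hU i).measurableSet
      rw [hi, add_zero, measureReal_eq_measureReal_iff] at h1
      exact h1.trans_le (hμK i)
    refine ⟨⟨ν, hν1⟩, (hmemK _).2 fun i => ?_, hνS⟩
    rcases le_or_gt (lev i) n with hi | hi
    · exact heq i (ha (some ⟨i, hi⟩))
    by_cases hx : ∃ x ∈ A n, x ∈ U i
    · obtain ⟨x, hxA, hxU⟩ := hx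
      exact (Measure.le_iff'.1 hν2 (U i)).trans (hxA.2 i hi.le hxU)
    · push Not at hx
      refine heq i (Finset.sum_eq_zero fun j _ => ?_)
      have : U i ∩ B j = ∅ := eq_empty_of_forall_notMem fun x hxB => hx x (hBA j hxB.2) hxB.1
      simp [this]
  obtain ⟨ν₁, hν₁, h₁⟩ := hfeas a ha1 ha
  obtain ⟨ν₂, hν₂, h₂⟩ := hfeas (-a) (by simpa using ha1) (by simpa using ha)
  have hsum : (ν₁ + ν₂ : Measure X) = (2 : ℝ≥0∞) • (μ : Measure X) := by
    refine Measure.ext fun S hS => ?_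
    rw [← measureReal_eq_measureReal_iff (by simp) (by simp [ENNReal.mul_eq_top])]
    rw [measureReal_add_apply, h₁ S hS, h₂ S hS]
    simp
    ring
  have hν : ν₁ = μ := hμext ν₁ hν₁ ν₂ hν₂ hsum
  refine ha0 (funext fun k => ?_)
  have hk := h₁ (B k) (hB k)
  rw [hν, Finset.sum_eq_single_of_mem k (Finset.mem_univ k) fun j _ hjk => by
    simp [(hBd hjk.symm).inter_eq], inter_self] at hk
  simpa [hB0 k] using hk

end Extremality

lemma exists_finset_nBall_cover [CompactSpace X] {T : X → X} (hT : Continuous T) (ε : ℝ) (n : ℕ) :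
    ∃ F : Finset X, ∀ x, ∃ y ∈ F, x ∈ nBall T n ε y := by
  obtain ⟨F, -, hF⟩ := isCompact_univ.elim_nhds_subcover (fun x => nBall T n ε x)
    fun x _ => (isOpen_nBall hT n ε x).mem_nhds (mem_nBall_self T n ε x)
  exact ⟨F, fun x => by simpa using hF (mem_univ x)⟩

lemma frequently_le_measure_nBall_of_atom [MeasurableSpace X] {T : X → X} {φ : ℕ → X → ℝ}
    {ε M c : ℝ} (h : IsTame T φ ε M) {μ : Measure X} {x : X} (hx : μ {x} ≠ 0) (hc : M + 1 ≤ c) :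
    ∃ᶠ n in atTop, ENNReal.ofReal (Real.exp (-n * c + φ n x)) ≤ μ (nBall T n ε x) := by
  have hlim : Tendsto (fun n : ℕ => ENNReal.ofReal (Real.exp (-n))) atTop (𝓝 0) := by
    simpa using ENNReal.tendsto_ofReal
      (Real.tendsto_exp_neg_atTop_nhds_zero.comp tendsto_natCast_atTop_atTop)
  refine Eventually.frequently ?_
  filter_upwards [hlim.eventually (gt_mem_nhds (pos_iff_ne_zero.2 hx))] with n hn
  refine le_trans (ENNReal.ofReal_le_ofReal (Real.exp_le_exp.2 ?_))
    (hn.le.trans (measure_mono (singleton_subset_iff.2 (mem_nBall_self T n ε x))))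
  have h1 := (le_abs_self _).trans (h.abs_le n x)
  have h2 : (n : ℝ) * (M + 1) ≤ n * c := by gcongr
  linarith

/-- A Frostman-type lemma: if the covering sums with exponent `s` do not vanish, then for every
`s' < s` there is a probability measure on `Z` whose neutralized balls have measure at most
`C e^{-ns' + φ_n}`, and at least exponentially small measure infinitely often. -/
lemma exists_prob_frostman [CompactSpace X] [MeasurableSpace X] [BorelSpace X] {T : X → X}
    (hT : Continuous T) {φ : ℕ → X → ℝ} {ε M s s' : ℝ} {Z : Set X} (hZ : IsCompact Z)
    (hε : 0 < ε) (h : IsTame T φ ε M) (hs : s' < s) (hM : Mlim T φ Z s ε ≠ 0) :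
    ∃ μ : Measure X, IsProbabilityMeasure μ ∧ μ Z = 1 ∧
      (∃ C > 0, ∃ N, ∀ n ≥ N, ∀ x,
        μ (nBall T n ε x) ≤ ENNReal.ofReal (C * Real.exp (-n * s' + φ n x))) ∧
      ∃ c : ℝ, ∀ᵐ x ∂μ, ∃ᶠ n in atTop,
        ENNReal.ofReal (Real.exp (-n * c + φ n x)) ≤ μ (nBall T n ε x) := by
  obtain ⟨κ, hκ⟩ := exists_four_le_exp hε
  obtain ⟨N, hN⟩ : ∃ N, MN T φ Z s ε N ≠ 0 := by
    by_contra! h0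
    exact hM (by simp [Mlim, h0])
  choose F hF using exists_finset_nBall_cover hT ε
  obtain ⟨r, hr, hrs⟩ := exists_between hs
  obtain ⟨C, hC, hex⟩ := exists_prob_le_weights hT hZ hε h hκ hrs hN hF
  let ι := Option {p : ℕ × X // N + 2 * κ ≤ p.1 ∧ p.2 ∈ F p.1}
  let lev : ι → ℕ := fun i => i.elim 0 fun p => p.1.1
  let U : ι → Set X := fun i => i.elim Zᶜ fun p => nBall T (p.1.1 - κ) ε p.1.2
  let w : ι → ℝ≥0∞ := fun i =>
    i.elim 0 fun p => ENNReal.ofReal (C * Real.exp (-(p.1.1 : ℝ) * r + φ p.1.1 p.1.2))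
  have hfin : ∀ n, {i | lev i ≤ n}.Finite := by
    intro n
    have h1 : (⋃ m ∈ Iic n, {m} ×ˢ (F m : Set X)).Finite := (finite_Iic n).biUnion fun m _ =>
      (finite_singleton m).prod (F m).finite_toSet
    refine ((finite_singleton none).union
      ((h1.preimage Subtype.val_injective.injOn).image some)).subset ?_
    rintro (_ | ⟨⟨m, y⟩, hm, hy⟩) hi
    · exact Or.inl rfl
    · refine Or.inr ⟨_, mem_iUnion₂.2 ⟨m, hi, mem_singleton m, hy⟩, rfl⟩
  have hU : ∀ i, IsOpen (U i) := by
    rintro (_ | ⟨⟨m, y⟩, hm, hy⟩)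
    · exact hZ.isClosed.isOpen_compl
    · exact isOpen_nBall hT _ _ _
  obtain ⟨μ, hμ, hμw, hsat⟩ := exists_prob_saturated lev hfin hU w (by
    intro L
    obtain ⟨μ, hμ, hμZ, hμw⟩ := hex (max L (N + 2 * κ)) (le_max_right _ _)
    refine ⟨μ, hμ, ?_⟩
    rintro (_ | ⟨⟨m, y⟩, hm, hy⟩) hi
    · exact ((prob_compl_eq_zero_iff hZ.isClosed.measurableSet).2 hμZ).le
    · exact hμw m ⟨hm, le_max_of_le_left hi⟩ y hy)
  refine ⟨μ, hμ, (prob_compl_eq_zero_iff hZ.isClosed.measurableSet).1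
    (nonpos_iff_eq_zero.1 (hμw none)), ?_, ?_⟩
  · obtain ⟨Cη, -, hdist⟩ := h.distortion (r - s') (sub_pos.2 hr)
    refine ⟨C * Real.exp Cη, by positivity, N + 2 * κ, fun n hn x => ?_⟩
    obtain ⟨y, hy, hxy⟩ := hF n x
    refine (measure_mono (nBall_subset_sub hκ (mem_nBall_comm.1 hxy))).trans
      ((hμw (some ⟨(n, y), hn, hy⟩)).trans (ENNReal.ofReal_le_ofReal ?_))
    rw [mul_assoc, ← Real.exp_add]
    refine mul_le_mul_of_nonneg_left (Real.exp_le_exp.2 ?_) hC.le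
    have h1 := (le_abs_self _).trans (hdist n y x hxy)
    simp only
    linarith
  · have hM0 := h.nonneg
    have hr0 := abs_nonneg r
    refine ⟨|r| + 2 * M + 1, ?_⟩
    filter_upwards [hsat] with x hx
    by_cases hx0 : μ {x} = 0
    swap
    · exact frequently_le_measure_nBall_of_atom h hx0 (by linarith)
    refine frequently_atTop.2 fun n₀ => ?_
    obtain ⟨D, hD⟩ := exists_nat_ge (2 * κ * (|r| + M) - Real.log (C / 2))
    obtain ⟨i, hi, hxi, hlt⟩ := hx hx0 (n₀ + D + 2 * κ + 1)
    rcases i with _ | ⟨⟨m, y⟩, hm, hy⟩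
    · exact absurd hi (by simp [lev])
    have hi : n₀ + D + 2 * κ + 1 ≤ m := hi
    have hxi : x ∈ nBall T (m - κ) ε y := hxi
    have hlt : ENNReal.ofReal (C * Real.exp (-(m : ℝ) * r + φ m y)) <
      2 * μ (nBall T (m - κ) ε y) := hlt
    obtain ⟨k, rfl⟩ : ∃ k, m = k + 2 * κ := ⟨m - 2 * κ, by omega⟩
    refine ⟨k, by omega, ?_⟩
    have hsub : nBall T (k + 2 * κ - κ) ε y ⊆ nBall T k ε x := by
      have := nBall_subset_sub hκ hxi
      rwa [show k + 2 * κ - κ - κ = k by omega] at this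
    refine le_trans ?_ (measure_mono hsub)
    have h2 : ENNReal.ofReal (C / 2 * Real.exp (-((k + 2 * κ : ℕ) : ℝ) * r + φ (k + 2 * κ) y)) ≤
        μ (nBall T (k + 2 * κ - κ) ε y) := by
      refine (ENNReal.mul_le_mul_iff_right two_ne_zero ofNat_ne_top).1 (le_trans (le_of_eq ?_) hlt.le)
      rw [← ENNReal.ofReal_ofNat 2, ← ENNReal.ofReal_mul zero_le_two]
      congr 1
      ring
    refine le_trans (ENNReal.ofReal_le_ofReal ?_) h2
    rw [← Real.exp_log (half_pos hC), ← Real.exp_add]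
    refine Real.exp_le_exp.2 ?_
    have h3 := (le_abs_self _).trans (h.abs_le k x)
    have h4 := (abs_le.1 (h.abs_le (k + 2 * κ) y)).1
    have h5 : (D : ℝ) ≤ k := by exact_mod_cast (by omega : D ≤ k)
    have h6 : ((k + 2 * κ : ℕ) : ℝ) * r ≤ (k + 2 * κ : ℕ) * |r| := by
      gcongr
      exact le_abs_self r
    push_cast at h4 h6 ⊢
    linarith

lemma sInf_eq_sSup_of_forall_notMem {S V : Set ℝ} (hV : V.Nonempty)
    (hle : ∀ v ∈ V, ∀ s ∈ S, v ≤ s) (hex : ∀ s ∉ S, ∀ s' < s, ∃ v ∈ V, s' ≤ v) :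
    sInf S = sSup V := by
  obtain ⟨v₀, hv₀⟩ := hV
  rcases S.eq_empty_or_nonempty with rfl | hS
  · rw [Real.sInf_empty, Real.sSup_of_not_bddAbove]
    rintro ⟨b, hb⟩
    obtain ⟨v, hv, hbv⟩ := hex (b + 2) (notMem_empty _) (b + 1) (by linarith)
    linarith [hb hv]
  obtain ⟨t, ht⟩ := hS
  refine le_antisymm (le_of_forall_lt fun a ha => ?_)
    (csSup_le ⟨v₀, hv₀⟩ fun v hv => le_csInf ⟨t, ht⟩ (hle v hv))
  obtain ⟨s', hs', hs's⟩ := exists_between ha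
  obtain ⟨s, hss, hs⟩ := exists_between hs's
  obtain ⟨v, hv, hsv⟩ := hex s (notMem_of_lt_csInf hs ⟨v₀, hle v₀ hv₀⟩) s' hss
  exact hs'.trans_le (hsv.trans (le_csSup ⟨t, fun v hv => hle v hv t ht⟩ hv))

lemma exists_prob_of_nonempty [MeasurableSpace X] [BorelSpace X] {Z : Set X} (hZ : IsCompact Z)
    (hZne : Z.Nonempty) :
    ∃ μ : Measure X, IsProbabilityMeasure μ ∧ μ Z = 1 := by
  obtain ⟨z, hz⟩ := hZne
  exact ⟨Measure.dirac z, inferInstance, by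
    rw [Measure.dirac_apply' _ hZ.isClosed.measurableSet, indicator_of_mem hz, Pi.one_apply]⟩

section VariationalPrinciple

variable [CompactSpace X] [MeasurableSpace X] [BorelSpace X] {T : X → X} {φ : ℕ → X → ℝ}
  {ε M : ℝ} {Z : Set X}

lemma Mcrit_eq_supBK (hT : Continuous T) (hφ : ∀ n, Continuous (φ n)) (hε : 0 < ε)
    (h : IsTame T φ ε M) (hZ : IsCompact Z) (hZne : Z.Nonempty) :
    Mcrit T φ Z ε = supBK T φ Z ε := by
  refine sInf_eq_sSup_of_forall_notMem ?_ ?_ ?_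
  · obtain ⟨μ, hμ, hμZ⟩ := exists_prob_of_nonempty hZ hZne
    exact ⟨_, μ, hμ, hμZ, rfl⟩
  · rintro _ ⟨μ, hμ, hμZ, rfl⟩ s hs
    exact PBK_le hT hφ h (frequently_le_measure_nBall hε h hZ.isClosed.measurableSet hμZ hs)
  · intro s hs s' hs'
    obtain ⟨μ, hμ, hμZ, ⟨C, hC, N, hN⟩, c, hc⟩ := exists_prob_frostman hT hZ hε h hs' hs
    exact ⟨_, ⟨μ, hμ, hμZ, rfl⟩, le_PBK hε hT hφ h hC hc hN⟩

lemma Mcrit_eq_supK (hT : Continuous T) (hε : 0 < ε) (h : IsTame T φ ε M) (hZ : IsCompact Z)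
    (hZne : Z.Nonempty) : Mcrit T φ Z ε = supK T φ Z ε := by
  refine sInf_eq_sSup_of_forall_notMem ?_ ?_ ?_
  · obtain ⟨μ, hμ, hμZ⟩ := exists_prob_of_nonempty hZ hZne
    exact ⟨_, μ, hμ, hμZ, rfl⟩
  · rintro _ ⟨μ, hμ, hμZ, rfl⟩ s hs
    exact PK_le h fun δ hδ => le_antisymm ((Λlim_le_Mlim hμZ hδ.1).trans (le_of_eq hs)) bot_le
  · intro s hs s' hs'
    obtain ⟨μ, hμ, hμZ, ⟨C, hC, N, hN⟩, c, hc⟩ := exists_prob_frostman hT hZ hε h hs' hs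
    obtain ⟨t, ht⟩ := exists_Λlim_eq_zero hT hε h hc
    exact ⟨_, ⟨μ, hμ, hμZ, rfl⟩, le_PK h hC hN ht⟩

end VariationalPrinciple

/-- variational principle for additive potentials. -/
theorem stmt17 {X : Type*} [MetricSpace X] [CompactSpace X] [MeasurableSpace X]
    [BorelSpace X] (T : X → X) (hT : Continuous T)
    (φ₀ : X → ℝ) (hφ₀ : Continuous φ₀)
    (φ : ℕ → X → ℝ) (hφ : φ = fun n x => ∑ j ∈ Finset.range n, φ₀ (T^[j] x))
    (Z : Set X) (hZne : Z.Nonempty) (hZ : IsCompact Z) :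
    PB T φ Z = limSupBK T φ Z ∧ PB T φ Z = limSupK T φ Z := by
  subst hφ
  have hcont : ∀ n, Continuous fun x => ∑ j ∈ Finset.range n, φ₀ (T^[j] x) := fun n =>
    continuous_finsetSum _ fun j _ => hφ₀.comp (hT.iterate j)
  constructor
  · refine congrArg sInf (image_congr fun ε hε => ?_)
    obtain ⟨M, hM⟩ := isTame_birkhoffSum (T := T) hφ₀ hε
    exact Mcrit_eq_supBK hT hcont hε hM hZ hZne
  · refine congrArg sInf (image_congr fun ε hε => ?_)
    obtain ⟨M, hM⟩ := isTame_birkhoffSum (T := T) hφ₀ hε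
    exact Mcrit_eq_supK hT hε hM hZ hZne
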